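/- arXiv:1707.00096 — 4 statements merged into one kernel-verified Lean document; each statement's English description precedes it below -/
import Mathlib

section
/- Let k be a nonzero integer and let c_1, …, c_n, c'_1, …, c'_{n'} be integers such that all n + n' of them are pairwise distinct. Assume that for every prime p there exists an integer a_p such that p² does not divide k·a_p + c_i for every i ∈ {1, …, n}. Then there exist a real number ε with 0 < ε < 1 and a real number C such that for all rational numbers s < t, the number of integers a with s < a < t such that k·a + c_i is squarefree for every i and k·a + c'_j is not squarefree for every j is at least ε·(t − s) − Σ_{i=1}^{n} (√|k·s + c_i| + √|k·t + c_i|) + C. -/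
open Real

/-- The integers of a residue class in an open real interval. -/
noncomputable def residueIoo (s t : ℝ) (m r : ℤ) : Finset ℤ :=
  {a ∈ Finset.Ioo ⌊s⌋ ⌈t⌉ | m ∣ a - r}

theorem mem_residueIoo {s t : ℝ} {m r a : ℤ} :
    a ∈ residueIoo s t m r ↔ (s < a ∧ a < t) ∧ m ∣ a - r := by
  simp [residueIoo, Int.floor_lt, Int.lt_ceil]

theorem residueIoo_eq_image (s t : ℝ) {m : ℤ} (hm : 0 < m) (r : ℤ) :
    residueIoo s t m r =
      (Finset.Ioo ⌊(s - r) / m⌋ ⌈(t - r) / m⌉).image (fun z => r + m * z) := by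
  have hm' : (0 : ℝ) < m := by exact_mod_cast hm
  ext a
  simp only [mem_residueIoo, Finset.mem_image, Finset.mem_Ioo, Int.floor_lt, Int.lt_ceil,
    div_lt_iff₀ hm', lt_div_iff₀ hm']
  constructor
  · rintro ⟨⟨h1, h2⟩, z, hz⟩
    have ha : a = r + m * z := by linarith
    subst ha
    push_cast at h1 h2
    exact ⟨z, ⟨by linarith, by linarith⟩, rfl⟩
  · rintro ⟨z, ⟨h1, h2⟩, rfl⟩
    push_cast
    exact ⟨⟨by linarith, by linarith⟩, z, by ring⟩

theorem card_residueIoo (s t : ℝ) {m : ℤ} (hm : 0 < m) (r : ℤ) :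
    (residueIoo s t m r).card = (⌈(t - r) / m⌉ - ⌊(s - r) / m⌋ - 1).toNat := by
  rw [residueIoo_eq_image s t hm, Finset.card_image_of_injective, Int.card_Ioo]
  intro x y h
  simpa [hm.ne'] using h

theorem le_card_residueIoo (s t : ℝ) {m : ℤ} (hm : 0 < m) (r : ℤ) :
    (t - s) / m - 1 ≤ ((residueIoo s t m r).card : ℝ) := by
  rw [card_residueIoo s t hm]
  have h : ((⌈(t - r) / m⌉ - ⌊(s - r) / m⌋ - 1 : ℤ) : ℝ) ≤
      ((⌈(t - r) / m⌉ - ⌊(s - r) / m⌋ - 1).toNat : ℝ) := by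
    exact_mod_cast Int.self_le_toNat _
  push_cast at h
  have h1 := Int.le_ceil ((t - r) / (m : ℝ))
  have h2 := Int.floor_le ((s - r) / (m : ℝ))
  have h3 : (t - s) / (m : ℝ) = (t - r) / m - (s - r) / m := by ring
  linarith

theorem card_residueIoo_le {s t : ℝ} (hst : s ≤ t) {m : ℤ} (hm : 0 < m) (r : ℤ) :
    ((residueIoo s t m r).card : ℝ) ≤ (t - s) / m + 1 := by
  rw [card_residueIoo s t hm]
  have hm' : (0 : ℝ) < m := by exact_mod_cast hm
  have h0 : 0 ≤ (t - s) / (m : ℝ) := div_nonneg (by linarith) hm'.le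
  rcases le_total 0 (⌈(t - r) / (m : ℝ)⌉ - ⌊(s - r) / (m : ℝ)⌋ - 1) with h | h
  · have h' : ((⌈(t - r) / (m : ℝ)⌉ - ⌊(s - r) / (m : ℝ)⌋ - 1).toNat : ℝ) =
        ((⌈(t - r) / (m : ℝ)⌉ - ⌊(s - r) / (m : ℝ)⌋ - 1 : ℤ) : ℝ) := by
      exact_mod_cast Int.toNat_of_nonneg h
    rw [h']
    push_cast
    have h1 := Int.ceil_lt_add_one ((t - r) / (m : ℝ))
    have h2 := Int.lt_floor_add_one ((s - r) / (m : ℝ))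
    have h3 : (t - s) / (m : ℝ) = (t - r) / m - (s - r) / m := by ring
    linarith
  · rw [Int.toNat_of_nonpos h]
    push_cast
    linarith

theorem card_filter_sq_dvd_le {s t : ℝ} (hst : s ≤ t) {M : ℤ} (hM : 0 < M) (r k c : ℤ)
    {p : ℕ} (hp : p ≠ 0) (hpk : IsCoprime (p : ℤ) k) (hpM : IsCoprime (p : ℤ) M) :
    (({a ∈ residueIoo s t M r | (p : ℤ) ^ 2 ∣ k * a + c}.card : ℕ) : ℝ) ≤
      (t - s) / M * ((p : ℝ) ^ 2)⁻¹ + 1 := by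
  have hm : 0 < M * (p : ℤ) ^ 2 := by positivity
  have hM' : (0 : ℝ) < M := by exact_mod_cast hM
  rcases Finset.eq_empty_or_nonempty {a ∈ residueIoo s t M r | (p : ℤ) ^ 2 ∣ k * a + c}
    with h | ⟨b, hb⟩
  · rw [h]
    have : 0 ≤ (t - s) / M := div_nonneg (by linarith) hM'.le
    simp only [Finset.card_empty, Nat.cast_zero]
    positivity
  · rw [Finset.mem_filter, mem_residueIoo] at hb
    have hsub : {a ∈ residueIoo s t M r | (p : ℤ) ^ 2 ∣ k * a + c} ⊆
        residueIoo s t (M * (p : ℤ) ^ 2) b := by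
      intro a ha
      rw [Finset.mem_filter, mem_residueIoo] at ha
      rw [mem_residueIoo]
      refine ⟨ha.1.1, hpM.symm.pow_right.mul_dvd ?_ ?_⟩
      · simpa using dvd_sub ha.1.2 hb.1.2
      · refine (hpk.pow_left (m := 2)).dvd_of_dvd_mul_left ?_
        have := dvd_sub ha.2 hb.2
        rwa [show k * a + c - (k * b + c) = k * (a - b) by ring] at this
    refine (Nat.cast_le.2 (Finset.card_le_card hsub)).trans
      ((card_residueIoo_le hst hm b).trans_eq ?_)
    push_cast
    rw [div_mul_eq_div_div, div_eq_mul_inv ((t - s) / (M : ℝ))]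

theorem exists_prime_sq_dvd_of_not_squarefree {x : ℤ} (hx : ¬ Squarefree x) :
    ∃ p : ℕ, p.Prime ∧ (p : ℤ) ^ 2 ∣ x := by
  rw [← Int.squarefree_natAbs, Nat.squarefree_iff_prime_squarefree] at hx
  push Not at hx
  obtain ⟨p, hp, h⟩ := hx
  refine ⟨p, hp, ?_⟩
  rw [sq]
  exact_mod_cast Int.natCast_dvd.2 h

theorem sqrt_abs_affine_le (k c : ℝ) {s t a : ℝ} (hs : s ≤ a) (ht : a ≤ t) :
    √|k * a + c| ≤ √|k * s + c| + √|k * t + c| := by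
  have h : |k * a + c| ≤ max |k * s + c| |k * t + c| := by
    rcases le_total 0 k with hk | hk
    · exact abs_le_max_abs_abs (by nlinarith) (by nlinarith)
    · rw [max_comm]
      exact abs_le_max_abs_abs (by nlinarith) (by nlinarith)
  rcases le_max_iff.1 h with h | h
  · exact (Real.sqrt_le_sqrt h).trans (le_add_of_nonneg_right (Real.sqrt_nonneg _))
  · exact (Real.sqrt_le_sqrt h).trans (le_add_of_nonneg_left (Real.sqrt_nonneg _))

theorem natCast_le_sqrt_abs_of_sq_dvd {p : ℕ} {x : ℤ} (hx : x ≠ 0) (h : (p : ℤ) ^ 2 ∣ x) :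
    (p : ℝ) ≤ √|(x : ℝ)| := by
  apply Real.le_sqrt_of_sq_le
  have := Int.le_of_dvd (abs_pos.2 hx) ((dvd_abs _ _).2 h)
  exact_mod_cast this

open scoped Classical in
theorem card_filter_not_squarefree_le {s t : ℝ} (hst : s ≤ t) {M : ℤ} (hM : 0 < M) (r : ℤ)
    {k : ℤ} (hk : k ≠ 0) (c : ℤ) {N : ℕ} (hN : N ≠ 0)
    (hlarge : ∀ p : ℕ, p.Prime → N < p → IsCoprime (p : ℤ) k ∧ IsCoprime (p : ℤ) M)
    (hsmall : ∀ a, M ∣ a - r → ∀ p : ℕ, p.Prime → p ≤ N → ¬ (p : ℤ) ^ 2 ∣ k * a + c) :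
    (({a ∈ residueIoo s t M r | ¬ Squarefree (k * a + c)}.card : ℕ) : ℝ) ≤
      1 + (t - s) / M * (N : ℝ)⁻¹ + (√|(k : ℝ) * s + c| + √|(k : ℝ) * t + c|) := by
  set Y := √|(k : ℝ) * s + c| + √|(k : ℝ) * t + c| with hY
  have hY0 : 0 ≤ Y := by positivity
  have hM' : (0 : ℝ) < M := by exact_mod_cast hM
  have hL : 0 ≤ (t - s) / (M : ℝ) := div_nonneg (by linarith) hM'.le
  set P := {p ∈ Finset.Ioc N ⌊Y⌋₊ | p.Prime} with hP
  have hsub : {a ∈ residueIoo s t M r | ¬ Squarefree (k * a + c)} ⊆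
      {a ∈ residueIoo s t M r | k * a + c = 0} ∪
        P.biUnion (fun p => {a ∈ residueIoo s t M r | (p : ℤ) ^ 2 ∣ k * a + c}) := by
    intro a ha
    rw [Finset.mem_filter] at ha
    obtain ⟨haT, ha⟩ := ha
    rw [Finset.mem_union, Finset.mem_filter]
    by_cases h0 : k * a + c = 0
    · exact Or.inl ⟨haT, h0⟩
    · right
      obtain ⟨p, hp, hpa⟩ := exists_prime_sq_dvd_of_not_squarefree ha
      have hmem := mem_residueIoo.1 haT
      simp only [hP, Finset.mem_biUnion, Finset.mem_filter, Finset.mem_Ioc]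
      refine ⟨p, ⟨⟨?_, ?_⟩, hp⟩, haT, hpa⟩
      · by_contra hle
        exact hsmall a hmem.2 p hp (not_lt.1 hle) hpa
      · apply Nat.le_floor
        refine (natCast_le_sqrt_abs_of_sq_dvd h0 hpa).trans ?_
        push_cast
        exact sqrt_abs_affine_le _ _ hmem.1.1.le hmem.1.2.le
  have hzero : ({a ∈ residueIoo s t M r | k * a + c = 0}.card) ≤ 1 := by
    rw [Finset.card_le_one]
    intro a ha b hb
    rw [Finset.mem_filter] at ha hb
    exact mul_left_cancel₀ hk (by linarith [ha.2, hb.2])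
  have hsum : ∑ p ∈ P, ((p : ℝ) ^ 2)⁻¹ ≤ (N : ℝ)⁻¹ := by
    calc ∑ p ∈ P, ((p : ℝ) ^ 2)⁻¹ ≤ ∑ p ∈ Finset.Ioc N (max N ⌊Y⌋₊), ((p : ℝ) ^ 2)⁻¹ := by
          apply Finset.sum_le_sum_of_subset_of_nonneg
          · exact (Finset.filter_subset _ _).trans
              (Finset.Ioc_subset_Ioc_right (le_max_right _ _))
          · intros
            positivity
      _ ≤ (N : ℝ)⁻¹ - ((max N ⌊Y⌋₊ : ℕ) : ℝ)⁻¹ := sum_Ioc_inv_sq_le_sub hN (le_max_left _ _)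
      _ ≤ (N : ℝ)⁻¹ := sub_le_self _ (by positivity)
  have hcardP : (P.card : ℝ) ≤ Y := by
    refine le_trans ?_ (Nat.floor_le hY0)
    exact_mod_cast (Finset.card_filter_le _ _).trans (by simp)
  calc (({a ∈ residueIoo s t M r | ¬ Squarefree (k * a + c)}.card : ℕ) : ℝ)
      ≤ ((1 + ∑ p ∈ P, {a ∈ residueIoo s t M r | (p : ℤ) ^ 2 ∣ k * a + c}.card : ℕ) : ℝ) := by
        refine Nat.cast_le.2 ((Finset.card_le_card hsub).trans ((Finset.card_union_le _ _).trans ?_))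
        exact add_le_add hzero Finset.card_biUnion_le
    _ ≤ 1 + ∑ p ∈ P, ((t - s) / M * ((p : ℝ) ^ 2)⁻¹ + 1) := by
        push_cast
        gcongr with p hp
        simp only [hP, Finset.mem_filter, Finset.mem_Ioc] at hp
        obtain ⟨h1, h2⟩ := hlarge p hp.2 hp.1.1
        exact card_filter_sq_dvd_le hst hM r k c hp.2.ne_zero h1 h2
    _ = 1 + (t - s) / M * ∑ p ∈ P, ((p : ℝ) ^ 2)⁻¹ + P.card := by
        rw [Finset.sum_add_distrib, ← Finset.mul_sum]
        simp [add_assoc]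
    _ ≤ 1 + (t - s) / M * (N : ℝ)⁻¹ + Y := by gcongr

theorem exists_int_forall_prime_sq_dvd_sub (N : ℕ) (b : ℕ → ℤ) :
    ∃ r : ℤ, ∀ p : ℕ, p.Prime → p ≤ N → (p : ℤ) ^ 2 ∣ r - b p := by
  let S := {p ∈ Finset.range (N + 1) | p.Prime}
  have hS : Set.Pairwise (S : Set ℕ) (Function.onFun Nat.Coprime fun p => p ^ 2) := by
    intro p hp q hq hpq
    simp only [S, Finset.coe_filter, Set.mem_ofPred_eq] at hp hq
    exact Nat.Coprime.pow 2 2 ((Nat.coprime_primes hp.2 hq.2).2 hpq)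
  obtain ⟨r, hr⟩ := Nat.chineseRemainderOfFinset (fun p => (b p % (p : ℤ) ^ 2).toNat)
    (fun p => p ^ 2) S (fun p hp => pow_ne_zero 2 (Finset.mem_filter.1 hp).2.ne_zero) hS
  refine ⟨r, fun p hp hpN => ?_⟩
  have h := hr p (Finset.mem_filter.2 ⟨Finset.mem_range.2 (by omega), hp⟩)
  have h' := (Int.natCast_modEq_iff.2 h).symm.dvd
  have hne : (p : ℤ) ^ 2 ≠ 0 := pow_ne_zero 2 (by exact_mod_cast hp.ne_zero)
  push_cast at h'
  rw [Int.toNat_of_nonneg (Int.emod_nonneg _ hne)] at h'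
  have h2 := dvd_sub h' (Int.dvd_self_sub_emod (x := b p) (m := (p : ℤ) ^ 2))
  rwa [sub_sub_sub_cancel_right] at h2

theorem isCoprime_of_prime_of_natAbs_lt {p : ℕ} (hp : p.Prime) {x : ℤ} (hx : x ≠ 0)
    (h : x.natAbs < p) : IsCoprime (p : ℤ) x := by
  rw [Int.isCoprime_iff_gcd_eq_one, Int.gcd, Int.natAbs_natCast]
  exact Nat.coprime_of_lt_prime (Int.natAbs_ne_zero.2 hx) h hp

theorem exists_sq_dvd_mul_add {p k : ℤ} (h : IsCoprime p k) (d : ℤ) :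
    ∃ a, p ^ 2 ∣ k * a + d := by
  obtain ⟨u, v, huv⟩ := h.pow_left (m := 2)
  exact ⟨-d * v, u * d, by linear_combination (-d) * huv⟩

/-- A residue class on which the `c i` terms have no small square prime factor while every
`c' j` term is divisible by the square of a prime. -/
theorem exists_residue_class {k : ℤ} (hk : k ≠ 0) {n n' : ℕ} (c : Fin n → ℤ) (c' : Fin n' → ℤ)
    (hdisj : ∀ i j, c i ≠ c' j)
    (hloc : ∀ p : ℕ, p.Prime → ∃ a : ℤ, ∀ i : Fin n, ¬ ((p : ℤ) ^ 2 ∣ k * a + c i)) (B : ℕ) :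
    ∃ (N : ℕ) (M r : ℤ), B ≤ N ∧ 0 < M ∧
      (∀ p : ℕ, p.Prime → N < p → IsCoprime (p : ℤ) k ∧ IsCoprime (p : ℤ) M) ∧
      ∀ a, M ∣ a - r →
        (∀ i, ∀ p : ℕ, p.Prime → p ≤ N → ¬ (p : ℤ) ^ 2 ∣ k * a + c i) ∧
        ∀ j, ¬ Squarefree (k * a + c' j) := by
  let K := k.natAbs + ∑ i, ∑ j, (c i - c' j).natAbs
  have hKk : k.natAbs ≤ K := Nat.le_add_right _ _
  have hKc : ∀ i j, (c i - c' j).natAbs ≤ K := fun i j =>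
    ((Finset.single_le_sum (f := fun j => (c i - c' j).natAbs) (fun _ _ => Nat.zero_le _)
      (Finset.mem_univ j)).trans
      (Finset.single_le_sum (f := fun i => ∑ j, (c i - c' j).natAbs) (fun _ _ => Nat.zero_le _)
        (Finset.mem_univ i))).trans (Nat.le_add_left _ _)
  let q : Fin n' → ℕ := fun j => Nat.nth Nat.Prime (K + j)
  have hq : ∀ j, (q j).Prime := fun j => Nat.prime_nth_prime _
  have hKq : ∀ j, K < q j := fun j => by
    have := Nat.add_two_le_nth_prime (K + j)
    simp only [q]
    omega
  have hqinj : Function.Injective q := fun i j h => by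
    have := Nat.nth_injective Nat.infinite_setOfPred_prime h
    exact Fin.ext (by omega)
  have hlocal : ∀ p : ℕ, ∃ a : ℤ, p.Prime → (∀ i, ¬ (p : ℤ) ^ 2 ∣ k * a + c i) ∧
      ∀ j, p = q j → (p : ℤ) ^ 2 ∣ k * a + c' j := by
    intro p
    by_cases hpq : ∃ j, p = q j
    · obtain ⟨j, rfl⟩ := hpq
      obtain ⟨a, ha⟩ := exists_sq_dvd_mul_add
        (isCoprime_of_prime_of_natAbs_lt (hq j) hk (hKk.trans_lt (hKq j))) (c' j)
      refine ⟨a, fun _ => ⟨fun i hi => ?_, fun j' hj' => hqinj hj' ▸ ha⟩⟩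
      have hd : ((q j : ℕ) : ℤ) ∣ c i - c' j := by
        have := (dvd_pow_self _ two_ne_zero).trans (dvd_sub hi ha)
        rwa [add_sub_add_left_eq_sub] at this
      have hu := (isCoprime_of_prime_of_natAbs_lt (hq j) (sub_ne_zero.2 (hdisj i j))
        ((hKc i j).trans_lt (hKq j))).isUnit_of_dvd' dvd_rfl hd
      exact (Nat.prime_iff_prime_int.1 (hq j)).not_isUnit hu
    · by_cases hp : p.Prime
      · obtain ⟨a, ha⟩ := hloc p hp
        exact ⟨a, fun _ => ⟨ha, fun j hj => (hpq ⟨j, hj⟩).elim⟩⟩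
      · exact ⟨0, fun h => (hp h).elim⟩
  choose b hb using hlocal
  let N := K + B + ∑ j, q j
  have hqN : ∀ j, q j ≤ N := fun j =>
    (Finset.single_le_sum (fun _ _ => Nat.zero_le _) (Finset.mem_univ j)).trans
      (Nat.le_add_left _ _)
  have hKN : K ≤ N := (Nat.le_add_right _ _).trans (Nat.le_add_right _ _)
  obtain ⟨r, hr⟩ := exists_int_forall_prime_sq_dvd_sub N b
  refine ⟨N, ((N.factorial : ℕ) : ℤ) ^ 2, r, (Nat.le_add_left _ _).trans (Nat.le_add_right _ _),
    by positivity, fun p hp hNp => ⟨?_, ?_⟩, fun a ha => ?_⟩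
  · exact isCoprime_of_prime_of_natAbs_lt hp hk ((hKk.trans hKN).trans_lt hNp)
  · exact (Nat.isCoprime_iff_coprime.2 (hp.coprime_factorial_of_lt hNp)).pow_right
  · have hdvd : ∀ p : ℕ, p.Prime → p ≤ N → ∀ d : ℤ,
        ((p : ℤ) ^ 2 ∣ k * a + d ↔ (p : ℤ) ^ 2 ∣ k * b p + d) := by
      intro p hp hpN d
      have h1 : (p : ℤ) ^ 2 ∣ ((N.factorial : ℕ) : ℤ) ^ 2 :=
        pow_dvd_pow_of_dvd (Int.natCast_dvd_natCast.2 (Nat.dvd_factorial hp.pos hpN)) 2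
      have h2 : (p : ℤ) ^ 2 ∣ a - b p := by
        have := dvd_add (h1.trans ha) (hr p hp hpN)
        rwa [sub_add_sub_cancel] at this
      rw [show k * a + d = k * (a - b p) + (k * b p + d) by ring]
      exact dvd_add_right (h2.mul_left k)
    refine ⟨fun i p hp hpN => ?_, fun j hsq => ?_⟩
    · rw [hdvd p hp hpN]
      exact (hb p hp).1 i
    · have h := (hdvd _ (hq j) (hqN j) _).2 ((hb _ (hq j)).2 j rfl)
      rw [sq] at h
      exact (Nat.prime_iff_prime_int.1 (hq j)).not_isUnit (hsq _ h)

/-- Quantitative genericity (Lemma on positive density, case `h = 1`): under local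
satisfiability, there are `ε ∈ (0,1)` and `C ∈ ℝ` such that for all rationals `s < t`,
the number of integers `a` with `s < a < t` solving the system is at least
`ε (t - s) - Σᵢ (√|k s + cᵢ| + √|k t + cᵢ|) + C`. -/
theorem int_system_solution_count_lower_bound
    (k : ℤ) (hk : k ≠ 0) (n n' : ℕ) (c : Fin n → ℤ) (c' : Fin n' → ℤ)
    (hdist : Function.Injective (Sum.elim c c'))
    (hloc : ∀ p : ℕ, p.Prime → ∃ a : ℤ, ∀ i : Fin n, ¬ ((p : ℤ) ^ 2 ∣ k * a + c i)) :
    ∃ ε : ℝ, 0 < ε ∧ ε < 1 ∧ ∃ C : ℝ, ∀ s t : ℚ, s < t →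
      ε * ((t : ℝ) - (s : ℝ))
          - (∑ i : Fin n, (Real.sqrt |(k : ℝ) * (s : ℝ) + (c i : ℝ)|
              + Real.sqrt |(k : ℝ) * (t : ℝ) + (c i : ℝ)|))
          + C
        ≤ ({a : ℤ | (s : ℚ) < (a : ℚ) ∧ (a : ℚ) < t ∧
            (∀ i : Fin n, Squarefree (k * a + c i)) ∧
            (∀ j : Fin n', ¬ Squarefree (k * a + c' j))}.ncard : ℝ) := by
  classical
  obtain ⟨N, M, r, hBN, hM, hlarge, hres⟩ := exists_residue_class hk c c'
    (fun i j h => by simpa using hdist (a₁ := Sum.inl i) (a₂ := Sum.inr j) h) hloc (2 * n + 1)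
  have hM1 : (1 : ℝ) ≤ M := by exact_mod_cast hM
  have hN0 : N ≠ 0 := by omega
  have hnN : (n : ℝ) * (N : ℝ)⁻¹ ≤ 1 / 2 := by
    rw [← div_eq_mul_inv, div_le_div_iff₀ (by positivity) two_pos]
    have : n * 2 ≤ 1 * N := by omega
    exact_mod_cast this
  refine ⟨1 / (2 * M), by positivity, by rw [div_lt_one (by positivity)]; linarith, -1 - n,
    fun s t hst => ?_⟩
  have hst' : (s : ℝ) ≤ t := by exact_mod_cast hst.le
  set G := {a : ℤ | (s : ℚ) < (a : ℚ) ∧ (a : ℚ) < t ∧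
    (∀ i : Fin n, Squarefree (k * a + c i)) ∧ (∀ j : Fin n', ¬ Squarefree (k * a + c' j))} with hG
  have hGfin : G.Finite := (Set.finite_Ioo ⌊s⌋ ⌈t⌉).subset fun a ha =>
    ⟨Int.floor_lt.2 ha.1, Int.lt_ceil.2 ha.2.1⟩
  have hsub : residueIoo s t M r ⊆ hGfin.toFinset ∪ Finset.univ.biUnion
      (fun i => {a ∈ residueIoo s t M r | ¬ Squarefree (k * a + c i)}) := by
    intro a ha
    have hmem := mem_residueIoo.1 ha
    simp only [Finset.mem_union, Set.Finite.mem_toFinset, Finset.mem_biUnion, Finset.mem_univ,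
      true_and, Finset.mem_filter, ha]
    by_cases h : ∃ i, ¬ Squarefree (k * a + c i)
    · exact Or.inr h
    · push Not at h
      exact Or.inl ⟨by exact_mod_cast hmem.1.1, by exact_mod_cast hmem.1.2, h, (hres a hmem.2).2⟩
  have hcard : ((residueIoo s t M r).card : ℝ) ≤ (G.ncard : ℝ) +
      ∑ i, ({a ∈ residueIoo s t M r | ¬ Squarefree (k * a + c i)}.card : ℝ) := by
    rw [Set.ncard_eq_toFinset_card G hGfin]
    exact_mod_cast (Finset.card_le_card hsub).trans ((Finset.card_union_le _ _).trans
      (Nat.add_le_add_left Finset.card_biUnion_le _))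
  have hbad := Finset.sum_le_sum fun i (_ : i ∈ Finset.univ) =>
    card_filter_not_squarefree_le hst' hM r hk (c i) hN0 hlarge fun a ha => (hres a ha).1 i
  rw [Finset.sum_add_distrib, Finset.sum_const, Finset.card_univ, Fintype.card_fin,
    nsmul_eq_mul] at hbad
  have hmain := le_card_residueIoo (s : ℝ) t hM r
  have hL : 0 ≤ ((t : ℝ) - s) / M := div_nonneg (by linarith) (by linarith)
  have hhalf : 1 / (2 * (M : ℝ)) * (t - s) = ((t : ℝ) - s) / M * (1 / 2) := by
    field_simp
  have := mul_le_mul_of_nonneg_left hnN hL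
  rw [hhalf]
  linarith
end

section
/- For every integer c there exist infinitely many integers a such that both a + c and a + c + 1 are squarefree. -/
open Finset in
/-- An odd `d` has at most `K / d² + 1` solutions `k < K` to `d² ∣ 4 k + r`. -/
lemma card_filter_sq_dvd_le_s5 (K r d : ℕ) (hd : Odd d) :
    #{k ∈ range K | d * d ∣ 4 * k + r} ≤ K / (d * d) + 1 := by
  rw [← card_range (K / (d * d) + 1)]
  refine card_le_card_of_injOn (· / (d * d)) ?_ ?_
  · intro k hk
    simp only [coe_filter, mem_range, Set.mem_ofPred_eq] at hk
    simpa [Nat.lt_succ_iff] using Nat.div_le_div_right hk.1.le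
  · intro a ha b hb hab
    simp only [coe_filter, mem_range, Set.mem_ofPred_eq] at ha hb hab
    have hmod : 4 * a ≡ 4 * b [MOD d * d] := by
      refine Nat.ModEq.add_right_cancel' r ?_
      exact ((Nat.modEq_zero_iff_dvd).2 ha.2).trans ((Nat.modEq_zero_iff_dvd).2 hb.2).symm
    have hcop : Nat.Coprime (d * d) 4 :=
      Nat.Coprime.pow_right 2 (Nat.coprime_two_right.2 (hd.mul hd))
    have h : a % (d * d) = b % (d * d) := Nat.ModEq.cancel_left_of_coprime hcop hmod
    rw [← Nat.div_add_mod a (d * d), ← Nat.div_add_mod b (d * d), hab, h]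

lemma sum_inv_odd_sq_le (J : ℕ) :
    ∑ j ∈ Finset.range J, (1 : ℚ) / ((2 * j + 3) * (2 * j + 3)) ≤ 1 / 4 - 1 / (4 * (J + 1)) := by
  induction J with
  | zero => norm_num
  | succ J ih =>
    rw [Finset.sum_range_succ]
    have h : (1 : ℚ) / ((2 * J + 3) * (2 * J + 3)) ≤ 1 / (4 * (J + 1)) - 1 / (4 * (J + 1 + 1)) := by
      have e : (1 : ℚ) / (4 * (J + 1)) - 1 / (4 * (J + 1 + 1)) = 1 / (4 * ((J + 1) * (J + 2))) := by
        field_simp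
        ring
      rw [e]
      exact one_div_le_one_div_of_le (by positivity) (by nlinarith)
    push_cast
    linarith

lemma exists_odd_sq_dvd_of_not_squarefree {n J : ℕ} (h4 : ¬ 4 ∣ n) (hn : n < 4 * (J * J))
    (hsq : ¬ Squarefree n) : ∃ j < J, (2 * j + 3) * (2 * j + 3) ∣ n := by
  rw [Nat.squarefree_iff_prime_squarefree] at hsq
  push Not at hsq
  obtain ⟨p, hp, hpn⟩ := hsq
  have hn0 : 0 < n := Nat.pos_of_ne_zero (by rintro rfl; simp at h4)
  have hp2 : p ≠ 2 := by rintro rfl; exact h4 hpn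
  obtain ⟨i, rfl⟩ := hp.odd_of_ne_two hp2
  have hi : i ≠ 0 := by rintro rfl; exact absurd hp (by norm_num)
  obtain ⟨j, rfl⟩ := Nat.exists_eq_succ_of_ne_zero hi
  refine ⟨j, ?_, hpn⟩
  have := Nat.le_of_dvd hn0 hpn
  simp only [Nat.succ_eq_add_one] at this
  nlinarith

open Finset in
/-- At most `J² / 4 + J` of the `4 k + r` with `k < J²` fail to be squarefree. -/
lemma card_filter_not_squarefree_le_s5 (J r : ℕ) (hr : 0 < r) (hr4 : r < 4) :
    (#{k ∈ range (J * J) | ¬ Squarefree (4 * k + r)} : ℚ) ≤ J * J / 4 + J := by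
  have hsub : {k ∈ range (J * J) | ¬ Squarefree (4 * k + r)} ⊆
      (range J).biUnion fun j ↦
        {k ∈ range (J * J) | (2 * j + 3) * (2 * j + 3) ∣ 4 * k + r} := by
    intro k hk
    simp only [mem_filter, mem_range, mem_biUnion] at hk ⊢
    obtain ⟨j, hj, hdvd⟩ :=
      exists_odd_sq_dvd_of_not_squarefree (J := J) (by omega) (by omega) hk.2
    exact ⟨j, hj, hk.1, hdvd⟩
  have hcard := (card_le_card hsub).trans (card_biUnion_le.trans
    (sum_le_sum fun j _ ↦ card_filter_sq_dvd_le_s5 (J * J) r (2 * j + 3) ⟨j + 1, by ring⟩))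
  calc (#{k ∈ range (J * J) | ¬ Squarefree (4 * k + r)} : ℚ)
      ≤ ∑ j ∈ range J, ((J * J / ((2 * j + 3) * (2 * j + 3)) : ℕ) + 1 : ℚ) := by
        exact_mod_cast hcard
    _ ≤ ∑ j ∈ range J, ((J * J : ℚ) * (1 / ((2 * j + 3) * (2 * j + 3))) + 1) := by
        gcongr with j
        refine Nat.cast_div_le.trans (le_of_eq ?_)
        push_cast
        ring
    _ = J * J * ∑ j ∈ range J, (1 : ℚ) / ((2 * j + 3) * (2 * j + 3)) + J := by
        rw [sum_add_distrib, ← mul_sum]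
        simp
    _ ≤ J * J * (1 / 4) + J := by
        gcongr
        refine (sum_inv_odd_sq_le J).trans (sub_le_self _ (by positivity))
    _ = J * J / 4 + J := by ring

open Finset in
lemma infinite_setOf_squarefree_four_mul_add :
    {k : ℕ | Squarefree (4 * k + 1) ∧ Squarefree (4 * k + 2)}.Infinite := by
  intro hfin
  set M := #hfin.toFinset with hM
  set J := 2 * M + 6 with hJ
  have hsub : range (J * J) ⊆ hfin.toFinset ∪
      ({k ∈ range (J * J) | ¬ Squarefree (4 * k + 1)} ∪
        {k ∈ range (J * J) | ¬ Squarefree (4 * k + 2)}) := by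
    intro k hk
    simp only [mem_union, Set.Finite.mem_toFinset, Set.mem_ofPred_eq, mem_filter, hk, true_and]
    tauto
  have hcard := (card_le_card hsub).trans
    ((card_union_le _ _).trans (Nat.add_le_add_left (card_union_le _ _) _))
  rw [card_range, ← hM] at hcard
  have hcard' : (J * J : ℚ) ≤ M + (#{k ∈ range (J * J) | ¬ Squarefree (4 * k + 1)} +
      #{k ∈ range (J * J) | ¬ Squarefree (4 * k + 2)}) := by
    exact_mod_cast hcard
  have h1 := card_filter_not_squarefree_le_s5 J 1 (by norm_num) (by norm_num)
  have h2 := card_filter_not_squarefree_le_s5 J 2 (by norm_num) (by norm_num)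
  have hJM : (J : ℚ) = 2 * M + 6 := by rw [hJ]; push_cast; ring
  have hM0 : (0 : ℚ) ≤ M := Nat.cast_nonneg M
  have : (J * J : ℚ) ≤ M + (J * J / 4 + J + (J * J / 4 + J)) := by linarith
  rw [hJM] at this
  nlinarith

/-- For every integer `c` there are infinitely many integers `a` such that both
`a + c` and `a + c + 1` are squarefree. -/
theorem infinitely_many_consecutive_squarefree_pairs (c : ℤ) :
    {a : ℤ | Squarefree (a + c) ∧ Squarefree (a + c + 1)}.Infinite := by
  have hinj : Function.Injective fun k : ℕ ↦ ((4 * k + 1 : ℕ) : ℤ) - c := by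
    intro a b hab
    simp only at hab
    omega
  refine (infinite_setOf_squarefree_four_mul_add.image hinj.injOn).mono ?_
  rintro _ ⟨k, ⟨h1, h2⟩, rfl⟩
  refine ⟨?_, ?_⟩
  · rw [sub_add_cancel]
    exact Int.squarefree_natCast.2 h1
  · rw [sub_add_cancel]
    exact_mod_cast Int.squarefree_natCast.2 h2
end

section
/- For every natural number l ≥ 1 and every subset S of {0, 1, …, l − 1}, there exist a natural number a and a positive natural number d such that for every t ∈ {0, 1, …, l − 1}, the number a + t·d is squarefree if and only if t ∈ S. (One may take d = (|S|!)².) -/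
/-- If `r` is coprime to `M`, at most `K / r + 1` of the first `K` terms of the progression
`b + k * M` are divisible by `r`. -/
theorem card_filter_dvd_add_mul_le {r M : ℕ} (hr : 0 < r) (hrM : Nat.Coprime r M) (b K : ℕ) :
    ((Finset.range K).filter fun k => r ∣ b + k * M).card ≤ K / r + 1 := by
  rcases ((Finset.range K).filter fun k => r ∣ b + k * M).eq_empty_or_nonempty with h | ⟨v, hv⟩
  · simp [h]
  · have hv' : r ∣ b + v * M := (Finset.mem_filter.1 hv).2
    have hsub : ((Finset.range K).filter fun k => r ∣ b + k * M) ⊆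
        (Finset.range K).filter fun k => k ≡ v [MOD r] := by
      refine Finset.monotone_filter_right _ fun k _ hk => ?_
      have h1 : b + k * M ≡ b + v * M [MOD r] :=
        ((Nat.modEq_zero_iff_dvd).2 hk).trans ((Nat.modEq_zero_iff_dvd).2 hv').symm
      exact Nat.ModEq.cancel_right_of_coprime hrM (Nat.ModEq.add_left_cancel' b h1)
    refine (Finset.card_le_card hsub).trans ?_
    rw [← Nat.count_eq_card_filter_range, Nat.count_modEq_card K hr]
    split_ifs <;> omega

/-- A sieve for squarefree values: finitely many progressions with common difference `M` that
have no local obstruction at the primes dividing `M` are simultaneously squarefree at some index,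
provided `M` is divisible by all primes that are small compared to the number of progressions. -/
theorem exists_forall_squarefree_add_mul {ι : Type*} (S : Finset ι) (b : ι → ℕ) {L M : ℕ}
    (hL : 0 < L) (hSL : S.card ≤ L) (hb : ∀ s ∈ S, 0 < b s)
    (hsmall : ∀ p : ℕ, p.Prime → p ≤ 2 * L → p ∣ M)
    (hloc : ∀ p : ℕ, p.Prime → p ∣ M → ∀ s ∈ S, ∀ k, ¬ p ^ 2 ∣ b s + k * M) :
    ∃ k, ∀ s ∈ S, Squarefree (b s + k * M) := by
  classical
  by_contra! hcon
  set C := ∑ s ∈ S, b s with hC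
  set K := 4 * L ^ 2 * (C + M) + 1 with hK
  set R := Nat.sqrt (C + K * M) with hR
  set P := (Finset.Ioc (2 * L) R).filter fun p => Nat.Coprime (p ^ 2) M with hP
  have hcover : Finset.range K ⊆ S.biUnion fun s => P.biUnion fun p =>
      (Finset.range K).filter fun k => p ^ 2 ∣ b s + k * M := by
    intro k hk
    obtain ⟨s, hs, hsq⟩ := hcon k
    rw [Nat.squarefree_iff_prime_squarefree] at hsq
    push Not at hsq
    obtain ⟨p, hp, hdvd⟩ := hsq
    rw [← sq] at hdvd
    have hpM : ¬ p ∣ M := fun h => hloc p hp h s hs k hdvd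
    have hle : p ^ 2 ≤ C + K * M := by
      refine (Nat.le_of_dvd (Nat.add_pos_left (hb s hs) _) hdvd).trans (Nat.add_le_add ?_ ?_)
      · exact Finset.single_le_sum (f := b) (fun _ _ => Nat.zero_le _) hs
      · exact Nat.mul_le_mul_right _ (Finset.mem_range.1 hk).le
    simp only [Finset.mem_biUnion, Finset.mem_filter, hP, Finset.mem_Ioc]
    refine ⟨s, hs, p, ⟨⟨?_, ?_⟩, ?_⟩, hk, hdvd⟩
    · by_contra! h
      exact hpM (hsmall p hp h)
    · exact Nat.le_sqrt'.2 hle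
    · exact Nat.Coprime.pow_left 2 ((Nat.Prime.coprime_iff_not_dvd hp).2 hpM)
  have hprime_sum : (∑ p ∈ P, ((K / p ^ 2 + 1 : ℕ) : ℝ)) ≤ K / (2 * L) + R := by
    calc (∑ p ∈ P, ((K / p ^ 2 + 1 : ℕ) : ℝ))
        ≤ ∑ p ∈ Finset.Ioc (2 * L) R, ((K / p ^ 2 + 1 : ℕ) : ℝ) :=
          Finset.sum_le_sum_of_subset_of_nonneg (Finset.filter_subset _ _)
            fun _ _ _ => Nat.cast_nonneg _
      _ ≤ ∑ p ∈ Finset.Ioc (2 * L) R, ((K : ℝ) * ((p : ℝ) ^ 2)⁻¹ + 1) := by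
          refine Finset.sum_le_sum fun p _ => ?_
          have := Nat.cast_div_le (α := ℝ) (m := K) (n := p ^ 2)
          push_cast at this ⊢
          rw [← div_eq_mul_inv]
          linarith
      _ = K * ∑ p ∈ Finset.Ioc (2 * L) R, ((p : ℝ) ^ 2)⁻¹ + (R - 2 * L : ℕ) := by
          simp [Finset.sum_add_distrib, Finset.mul_sum]
      _ ≤ K * (2 * L : ℝ)⁻¹ + R := by
          gcongr
          · rcases le_total (2 * L) R with h | h
            · have := sum_Ioc_inv_sq_le_sub (α := ℝ) (k := 2 * L) (n := R) (by omega) h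
              push_cast at this
              have hR0 : (0 : ℝ) ≤ (R : ℝ)⁻¹ := by positivity
              linarith
            · rw [Finset.Ioc_eq_empty_of_le h, Finset.sum_empty]
              positivity
          · omega
      _ = K / (2 * L) + R := by rw [div_eq_mul_inv]
  have hcount : (K : ℝ) ≤ L * (K / (2 * L) + R) := by
    have h1 : K ≤ S.card * ∑ p ∈ P, (K / p ^ 2 + 1) := by
      calc K = (Finset.range K).card := (Finset.card_range K).symm
        _ ≤ _ := Finset.card_le_card hcover
        _ ≤ _ := by
          refine Finset.card_biUnion_le_card_mul _ _ _ fun s _ => ?_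
          refine Finset.card_biUnion_le.trans (Finset.sum_le_sum fun p hp => ?_)
          simp only [hP, Finset.mem_filter, Finset.mem_Ioc] at hp
          exact card_filter_dvd_add_mul_le (pow_pos (by omega) 2) hp.2 _ _
    have h2 : (K : ℝ) ≤ S.card * ∑ p ∈ P, ((K / p ^ 2 + 1 : ℕ) : ℝ) := by exact_mod_cast h1
    refine h2.trans ?_
    gcongr
  have hLR : (K : ℝ) ≤ 2 * L * R := by
    have hL' : (0 : ℝ) < L := by exact_mod_cast hL
    have : (L : ℝ) * (K / (2 * L) + R) = K / 2 + L * R := by field_simp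
    linarith
  have hLR' : K ≤ 2 * L * R := by exact_mod_cast hLR
  have hR2 : R ^ 2 ≤ C + K * M := Nat.sqrt_le' _
  have hK1 : 1 ≤ K := by omega
  have hlt : 4 * L ^ 2 * (C + K * M) < K * K := by
    calc 4 * L ^ 2 * (C + K * M) ≤ 4 * L ^ 2 * (K * C + K * M) := by
          gcongr
          exact Nat.le_mul_of_pos_left _ hK1
      _ = K * (4 * L ^ 2 * (C + M)) := by ring
      _ < K * K := Nat.mul_lt_mul_of_pos_left (by omega) hK1
  have : K * K ≤ 4 * L ^ 2 * (C + K * M) := by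
    calc K * K ≤ (2 * L * R) * (2 * L * R) := Nat.mul_le_mul hLR' hLR'
      _ = 4 * L ^ 2 * R ^ 2 := by ring
      _ ≤ _ := Nat.mul_le_mul_left _ hR2
  omega

/-- For every `l ≥ 1` and every subset `S` of `{0, …, l-1}`, there are a natural number
`a` and a positive natural number `d` such that for each `t < l`, the integer `a + t·d`
is squarefree if and only if `t ∈ S`. -/
theorem exists_arith_progression_squarefree_pattern
    (l : ℕ) (hl : 1 ≤ l) (S : Finset ℕ) (hS : S ⊆ Finset.range l) :
    ∃ a d : ℕ, 0 < d ∧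
      ∀ t : ℕ, t < l → (Squarefree ((a : ℤ) + (t : ℤ) * (d : ℤ)) ↔ t ∈ S) := by
  classical
  set d := ((2 * l).factorial) ^ 2 with hd
  have hd0 : 0 < d := pow_pos (Nat.factorial_pos _) 2
  set q : ℕ → ℕ := fun t => Nat.nth Nat.Prime (2 * l + t) with hq
  have hqp : ∀ t, (q t).Prime := fun t => Nat.prime_nth_prime _
  have hq_gt : ∀ t, 2 * l < q t := fun t => by
    have := Nat.add_two_le_nth_prime (2 * l + t)
    simp only [hq]
    omega
  have hq_inj : Function.Injective q := fun t u h =>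
    Nat.add_left_cancel (Nat.nth_injective Nat.infinite_setOfPred_prime h)
  have hqd : ∀ t, ¬ q t ∣ d := fun t h =>
    (hq_gt t).not_ge (((hqp t).dvd_factorial).1 ((hqp t).dvd_of_dvd_pow h))
  set T := Finset.range l \ S with hT
  set Q := ∏ t ∈ T, q t ^ 2 with hQ
  have hcop : Nat.Coprime d Q := Nat.Coprime.prod_right fun t _ =>
    (Nat.Coprime.pow_left 2 (((hqp t).coprime_iff_not_dvd).2 (hqd t))).symm
  obtain ⟨a', ha'⟩ := Nat.chineseRemainderOfFinset (fun t => t * d * (q t ^ 2 - 1))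
    (fun t => q t ^ 2) T (fun t _ => pow_ne_zero 2 (hqp t).ne_zero) (fun t _ u _ htu =>
      Nat.Coprime.pow 2 2 ((Nat.coprime_primes (hqp t) (hqp u)).2 (hq_inj.ne htu)))
  obtain ⟨a, ha1, haQ⟩ := Nat.chineseRemainder hcop 1 a'
  have hqQ : ∀ t ∈ T, q t ^ 2 ∣ Q := fun t ht => Finset.dvd_prod_of_mem (fun t => q t ^ 2) ht
  have hdvd : ∀ t ∈ T, q t ^ 2 ∣ a + t * d := by
    intro t ht
    have h1 : a ≡ t * d * (q t ^ 2 - 1) [MOD q t ^ 2] :=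
      (haQ.of_dvd (hqQ t ht)).trans (ha' t ht)
    have h2 : t * d * (q t ^ 2 - 1) + t * d = t * d * q t ^ 2 := by
      obtain ⟨m, hm⟩ := Nat.exists_eq_succ_of_ne_zero (pow_ne_zero 2 (hqp t).ne_zero)
      rw [hm]
      simp
      ring
    have h3 := h1.add_right (t * d)
    rw [h2] at h3
    exact (h3.dvd_iff dvd_rfl).2 (dvd_mul_left _ _)
  have hunit : ∀ p : ℕ, p.Prime → p ∣ d → ∀ x, ¬ p ∣ a + x * d := by
    intro p hp hpd x h
    have h1 : p ∣ a := (Nat.dvd_add_left (hpd.mul_left x)).1 h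
    exact hp.one_lt.ne' (Nat.dvd_one.1 (((ha1.of_dvd hpd).dvd_iff dvd_rfl).1 h1))
  have hsmall : ∀ p : ℕ, p.Prime → p ≤ 2 * l → p ∣ d := fun p hp h =>
    dvd_pow ((hp.dvd_factorial).2 h) two_ne_zero
  obtain ⟨k, hk⟩ := exists_forall_squarefree_add_mul S (fun t => a + t * d) (L := l)
    (M := d * Q) hl (by simpa using Finset.card_le_card hS)
    (fun s _ => Nat.pos_of_ne_zero fun h =>
      hunit 2 Nat.prime_two (hsmall 2 Nat.prime_two (by omega)) s (by simp [h]))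
    (fun p hp h => (hsmall p hp h).mul_right Q) (by
      intro p hp hpM s hs k hdiv
      have hdiv' : p ∣ a + s * d + k * (d * Q) := (dvd_pow_self p two_ne_zero).trans hdiv
      rcases hp.dvd_mul.1 hpM with hpd | hpQ
      · exact hunit p hp hpd (s + k * Q) (by convert hdiv' using 1; ring)
      · obtain ⟨t, ht, hpt⟩ := (hp.prime.dvd_finsetProd_iff _).1 hpQ
        obtain rfl : p = q t := (Nat.prime_dvd_prime_iff_eq hp (hqp t)).1 (hp.dvd_of_dvd_pow hpt)
        have h1 : q t ∣ a + s * d := (Nat.dvd_add_left ((hpQ.mul_left d).mul_left k)).1 hdiv'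
        have h2 : q t ∣ a + t * d := (dvd_pow_self _ two_ne_zero).trans (hdvd t ht)
        have h3 : s * d ≡ t * d [MOD q t] := Nat.ModEq.add_left_cancel' a
          (((Nat.modEq_zero_iff_dvd).2 h1).trans ((Nat.modEq_zero_iff_dvd).2 h2).symm)
        have h4 : s ≡ t [MOD q t] := Nat.ModEq.cancel_right_of_coprime
          (((hqp t).coprime_iff_not_dvd).2 (hqd t)) h3
        have hsl := Finset.mem_range.1 (hS hs)
        have htT := Finset.mem_sdiff.1 ht
        have htl := Finset.mem_range.1 htT.1
        have hgt := hq_gt t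
        exact htT.2 (h4.eq_of_lt_of_lt (by omega) (by omega) ▸ hs))
  refine ⟨a + k * (d * Q), d, hd0, fun t ht => ?_⟩
  have hcast : ((a + k * (d * Q) : ℕ) : ℤ) + (t : ℤ) * (d : ℤ) =
      ((a + t * d + k * (d * Q) : ℕ) : ℤ) := by
    push_cast
    ring
  rw [hcast, Int.squarefree_natCast]
  refine ⟨fun hsq => ?_, hk t⟩
  by_contra hts
  have htT : t ∈ T := Finset.mem_sdiff.2 ⟨Finset.mem_range.2 ht, hts⟩
  have h : q t * q t ∣ a + t * d + k * (d * Q) := by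
    rw [← sq]
    exact dvd_add (hdvd t htT) (((hqQ t htT).mul_left d).mul_left k)
  exact (hqp t).one_lt.ne' (Nat.isUnit_iff.1 (hsq _ h))
end

section
/- For all natural numbers k ≥ 1 and n ≥ 1 there exist integers b_{i,j} for 0 ≤ i < k and 0 ≤ j < n, and integers a_Δ indexed by the subsets Δ of {0, …, n−1}^k, such that for every subset Δ ⊆ {0, …, n−1}^k and every tuple (j_0, …, j_{k−1}) ∈ {0, …, n−1}^k, the integer a_Δ + b_{0,j_0} + b_{1,j_1} + ⋯ + b_{k−1,j_{k−1}} is squarefree if and only if (j_0, …, j_{k−1}) ∈ Δ. -/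
/-- If `Q` is coprime to `m`, then `m ∣ c + Q * t` has at most `X / m + 1` solutions `t < X`. -/
theorem card_filter_dvd_add_mul_le_s14 (m c Q X : ℕ) (hm : 0 < m) (hQ : Nat.Coprime m Q) :
    (((Finset.range X).filter fun t => m ∣ c + Q * t).card : ℝ) ≤ X * (m : ℝ)⁻¹ + 1 := by
  by_cases h : ∃ v, m ∣ c + Q * v
  · obtain ⟨v, hv⟩ := h
    have hsub : ((Finset.range X).filter fun t => m ∣ c + Q * t) ⊆
        (Finset.range X).filter fun t => t ≡ v [MOD m] := by
      intro t ht
      simp only [Finset.mem_filter] at ht ⊢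
      refine ⟨ht.1, ?_⟩
      have h1 : c + Q * t ≡ c + Q * v [MOD m] :=
        ((Nat.modEq_zero_iff_dvd).2 ht.2).trans ((Nat.modEq_zero_iff_dvd).2 hv).symm
      exact Nat.ModEq.cancel_left_of_coprime hQ (Nat.ModEq.add_left_cancel' c h1)
    have hcard := Finset.card_le_card hsub
    rw [← Nat.count_eq_card_filter_range (fun t => t ≡ v [MOD m]),
      Nat.count_modEq_card X hm v] at hcard
    have h2 : ((Finset.range X).filter fun t => m ∣ c + Q * t).card ≤ X / m + 1 := by
      refine hcard.trans ?_
      split_ifs <;> omega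
    have h3 : ((X / m : ℕ) : ℝ) ≤ (X : ℝ) / m := Nat.cast_div_le
    calc (((Finset.range X).filter fun t => m ∣ c + Q * t).card : ℝ)
        ≤ ((X / m + 1 : ℕ) : ℝ) := by exact_mod_cast h2
      _ ≤ X * (m : ℝ)⁻¹ + 1 := by
        push_cast
        rw [← div_eq_mul_inv]
        linarith
  · have he : ((Finset.range X).filter fun t => m ∣ c + Q * t) = ∅ :=
      Finset.filter_eq_empty_iff.2 fun t _ ht => h ⟨t, ht⟩
    rw [he]
    simp only [Finset.card_empty, Nat.cast_zero]
    positivity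

/-- Finitely many arithmetic progressions with common difference `Q` take simultaneously squarefree
values, provided that `Q` is divisible by all small primes and the initial terms are coprime
to `Q`. -/
theorem exists_forall_squarefree_add_mul_s14 {ι : Type*} (S : Finset ι) (c : ι → ℕ) (Q N : ℕ)
    (hN : 0 < N) (hS : S.card ≤ N) (hsmall : ∀ p, p.Prime → p ≤ 2 * N → p ∣ Q)
    (hc : ∀ p, p.Prime → p ∣ Q → ∀ i ∈ S, ¬ p ∣ c i) :
    ∃ t, ∀ i ∈ S, Squarefree (c i + Q * t) := by
  classical
  by_contra! hbad
  set C := ∑ i ∈ S, c i with hC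
  set X := 4 * N ^ 2 * (C + Q) + 1 with hX
  set M := Nat.sqrt (C + Q * X) with hM
  have hcpos : ∀ i ∈ S, 0 < c i := fun i hi => Nat.pos_of_ne_zero fun h0 =>
    hc 2 Nat.prime_two (hsmall 2 Nat.prime_two (by omega)) i hi (h0 ▸ dvd_zero 2)
  set R := (Finset.Ioc (2 * N) M).filter fun d => Nat.Coprime d Q with hR
  have hcover : Finset.range X ⊆
      S.biUnion fun i => R.biUnion fun d => (Finset.range X).filter fun t => d ^ 2 ∣ c i + Q * t := by
    intro t ht
    obtain ⟨i, hi, hsq⟩ := hbad t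
    rw [Nat.squarefree_iff_prime_squarefree] at hsq
    push Not at hsq
    obtain ⟨p, hp, hdvd⟩ := hsq
    rw [← pow_two] at hdvd
    have hpQ : ¬ p ∣ Q := fun h => hc p hp h i hi
      ((Nat.dvd_add_left (h.mul_right t)).1 ((dvd_pow_self p two_ne_zero).trans hdvd))
    have hpN : 2 * N < p := not_le.1 fun h => hpQ (hsmall p hp h)
    have hpM : p ≤ M := by
      rw [hM, Nat.le_sqrt']
      refine (Nat.le_of_dvd (by have := hcpos i hi; omega) hdvd).trans ?_
      exact add_le_add (Finset.single_le_sum (f := c) (fun _ _ => Nat.zero_le _) hi)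
        (Nat.mul_le_mul_left Q (Finset.mem_range.1 ht).le)
    simp only [Finset.mem_biUnion, Finset.mem_filter, hR, Finset.mem_Ioc]
    exact ⟨i, hi, p, ⟨⟨hpN, hpM⟩, (Nat.Prime.coprime_iff_not_dvd hp).2 hpQ⟩, ht, hdvd⟩
  have hNR : (0 : ℝ) < N := by exact_mod_cast hN
  have hsum : ∑ d ∈ R, (((d : ℝ) ^ 2)⁻¹) ≤ ((2 * N : ℕ) : ℝ)⁻¹ := by
    refine (Finset.sum_le_sum_of_subset_of_nonneg (Finset.filter_subset _ _)
      fun _ _ _ => by positivity).trans ?_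
    rcases le_total (2 * N) M with h | h
    · exact (sum_Ioc_inv_sq_le_sub (by omega) h).trans (sub_le_self _ (by positivity))
    · rw [Finset.Ioc_eq_empty_of_le h, Finset.sum_empty]
      positivity
  have hRcard : (R.card : ℝ) ≤ M := by
    have := Finset.card_filter_le (Finset.Ioc (2 * N) M) fun d => Nat.Coprime d Q
    rw [Nat.card_Ioc] at this
    exact_mod_cast this.trans (Nat.sub_le _ _)
  have hprog : ∀ i ∈ S, ((R.biUnion fun d =>
      (Finset.range X).filter fun t => d ^ 2 ∣ c i + Q * t).card : ℝ) ≤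
        X * ((2 * N : ℕ) : ℝ)⁻¹ + M := by
    intro i _
    calc ((R.biUnion fun d => (Finset.range X).filter fun t => d ^ 2 ∣ c i + Q * t).card : ℝ)
        ≤ ∑ d ∈ R, (((Finset.range X).filter fun t => d ^ 2 ∣ c i + Q * t).card : ℝ) := by
          exact_mod_cast Finset.card_biUnion_le
      _ ≤ ∑ d ∈ R, (X * ((d : ℝ) ^ 2)⁻¹ + 1) := by
          refine Finset.sum_le_sum fun d hd => ?_
          simp only [hR, Finset.mem_filter, Finset.mem_Ioc] at hd
          have := card_filter_dvd_add_mul_le_s14 (d ^ 2) (c i) Q X (pow_pos (by omega) 2)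
            (hd.2.pow_left 2)
          exact_mod_cast this
      _ = X * ∑ d ∈ R, (((d : ℝ) ^ 2)⁻¹) + R.card := by
          rw [Finset.sum_add_distrib, ← Finset.mul_sum]
          simp
      _ ≤ X * ((2 * N : ℕ) : ℝ)⁻¹ + M := by gcongr
  have htotal : (X : ℝ) ≤ N * (X * ((2 * N : ℕ) : ℝ)⁻¹ + M) := by
    calc (X : ℝ) = ((Finset.range X).card : ℝ) := by rw [Finset.card_range]
      _ ≤ ∑ i ∈ S, ((R.biUnion fun d =>
          (Finset.range X).filter fun t => d ^ 2 ∣ c i + Q * t).card : ℝ) := by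
          exact_mod_cast (Finset.card_le_card hcover).trans Finset.card_biUnion_le
      _ ≤ ∑ _i ∈ S, (X * ((2 * N : ℕ) : ℝ)⁻¹ + M) := Finset.sum_le_sum hprog
      _ = S.card * (X * ((2 * N : ℕ) : ℝ)⁻¹ + M) := by
          rw [Finset.sum_const, nsmul_eq_mul]
      _ ≤ N * (X * ((2 * N : ℕ) : ℝ)⁻¹ + M) := by gcongr
  have hhalf : (N : ℝ) * (X * ((2 * N : ℕ) : ℝ)⁻¹ + M) = X / 2 + N * M := by
    push_cast
    field_simp
  have hXle : X ≤ 2 * N * M := by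
    have : (X : ℝ) ≤ 2 * N * M := by linarith
    exact_mod_cast this
  have hMsq : M ^ 2 ≤ C + Q * X := Nat.sqrt_le' _
  have h1X : 1 ≤ X := by omega
  have hlt : X ^ 2 < X ^ 2 :=
    calc X ^ 2 ≤ (2 * N * M) ^ 2 := Nat.pow_le_pow_left hXle 2
      _ = 4 * N ^ 2 * M ^ 2 := by ring
      _ ≤ 4 * N ^ 2 * (C + Q * X) := Nat.mul_le_mul_left _ hMsq
      _ ≤ 4 * N ^ 2 * (C * X + Q * X) := by
          gcongr
          exact Nat.le_mul_of_pos_right C h1X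
      _ = 4 * N ^ 2 * (C + Q) * X := by ring
      _ < X * X := Nat.mul_lt_mul_of_pos_right (by omega) h1X
      _ = X ^ 2 := (pow_two X).symm
  exact lt_irrefl _ hlt

/-- There are injective families of arbitrarily large primes indexed by a finite type. -/
theorem exists_injective_prime_gt (ι : Type*) [Finite ι] (B : ℕ) :
    ∃ p : ι → ℕ, Function.Injective p ∧ ∀ i, (p i).Prime ∧ B < p i := by
  obtain ⟨m, ⟨e⟩⟩ := Finite.exists_equiv_fin ι
  have hmono := Nat.nth_strictMono Nat.infinite_setOfPred_prime
  refine ⟨fun i => Nat.nth Nat.Prime (B + 1 + e i), fun i j h => ?_, fun i =>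
    ⟨Nat.prime_nth_prime _, ?_⟩⟩
  · have := hmono.injective h
    exact e.injective (Fin.ext (by omega))
  · have : B + 1 + e i ≤ Nat.nth Nat.Prime (B + 1 + e i) := hmono.le_apply
    show B < Nat.nth Nat.Prime (B + 1 + e i)
    omega

/-- Every squarefreeness pattern is realised by a translate of a finite family of distinct natural
numbers, provided these are divisible by all small primes. -/
theorem exists_squarefree_add_iff_mem {ι : Type*} [Fintype ι] [Nonempty ι] (s : ι → ℕ)
    (hs : Function.Injective s) (hdvd : ∀ i, (2 * Fintype.card ι).factorial ∣ s i) (Δ : Set ι) :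
    ∃ a : ℕ, ∀ i, Squarefree (a + s i) ↔ i ∈ Δ := by
  classical
  set N := Fintype.card ι with hN
  have hNpos : 0 < N := Fintype.card_pos
  set P := (2 * N).factorial with hP
  obtain ⟨p, hpinj, hp⟩ := exists_injective_prime_gt ι (2 * N + ∑ i, s i)
  have hsp : ∀ i j, s i < p j := fun i j => by
    have := Finset.single_le_sum (f := s) (fun _ _ => Nat.zero_le _) (Finset.mem_univ i)
    have := (hp j).2
    omega
  set T := Finset.univ.filter fun i => i ∉ Δ with hT
  have hpair : Set.Pairwise (T : Set ι) (Function.onFun Nat.Coprime fun i => p i ^ 2) :=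
    fun i _ j _ hij => Nat.Coprime.pow 2 2
      ((Nat.coprime_primes (hp i).1 (hp j).1).2 (hpinj.ne hij))
  obtain ⟨x, hx⟩ := Nat.chineseRemainderOfFinset (fun i => p i ^ 2 - s i) (fun i => p i ^ 2) T
    (fun i _ => pow_ne_zero 2 (hp i).1.ne_zero) hpair
  have hcop : Nat.Coprime P (∏ i ∈ T, p i ^ 2) := Nat.Coprime.prod_right fun i _ =>
    Nat.Coprime.pow_right 2 (((hp i).1.coprime_iff_not_dvd.2 fun h => by
      have := ((hp i).1.dvd_factorial).1 h
      have := (hp i).2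
      omega).symm)
  obtain ⟨y, hyP, hyT⟩ := Nat.chineseRemainder hcop 1 x
  have hyi : ∀ i ∈ T, p i ^ 2 ∣ y + s i := by
    intro i hi
    have h1 : y ≡ p i ^ 2 - s i [MOD p i ^ 2] :=
      (hyT.of_dvd (Finset.dvd_prod_of_mem (fun i => p i ^ 2) hi)).trans (hx i hi)
    have h2 := h1.add_right (s i)
    rw [Nat.sub_add_cancel ((hsp i i).le.trans (Nat.le_self_pow two_ne_zero _))] at h2
    exact (Nat.modEq_zero_iff_dvd).1 (h2.trans (Nat.modEq_zero_iff_dvd.2 dvd_rfl))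
  obtain ⟨t, ht⟩ := exists_forall_squarefree_add_mul_s14 (Finset.univ.filter fun i => i ∈ Δ)
    (fun i => y + s i) (P * ∏ i ∈ T, p i ^ 2) N hNpos
    (Finset.card_filter_le _ _)
    (fun q hq hle => (hq.dvd_factorial.2 hle).mul_right _) (by
      intro q hq hqQ i hi hqi
      have hiΔ : i ∈ Δ := (Finset.mem_filter.1 hi).2
      rcases hq.dvd_mul.1 hqQ with h | h
      · have h1 : q ∣ y := (Nat.dvd_add_left (h.trans (hdvd i))).1 hqi
        exact hq.one_lt.ne' (Nat.dvd_one.1 (((hyP.of_dvd h).dvd_iff dvd_rfl).1 h1))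
      · obtain ⟨j, hj, hqj⟩ := (hq.prime.dvd_finsetProd_iff _).1 h
        have hqp : q = p j := (Nat.prime_dvd_prime_iff_eq hq (hp j).1).1 (hq.dvd_of_dvd_pow hqj)
        subst hqp
        have h1 : y + s i ≡ y + s j [MOD p j] := (Nat.modEq_zero_iff_dvd.2 hqi).trans
          (Nat.modEq_zero_iff_dvd.2 ((dvd_pow_self _ two_ne_zero).trans (hyi j hj))).symm
        have h2 := (Nat.ModEq.add_left_cancel' y h1).eq_of_lt_of_lt (hsp i j) (hsp j j)
        have h3 : j ∉ Δ := (Finset.mem_filter.1 hj).2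
        exact h3 (hs h2 ▸ hiΔ))
  refine ⟨y + (P * ∏ i ∈ T, p i ^ 2) * t, fun i => ⟨fun hsq => ?_, fun hi => ?_⟩⟩
  · by_contra hi
    have hiT : i ∈ T := by simp [hT, hi]
    have h1 : p i * p i ∣ y + (P * ∏ i ∈ T, p i ^ 2) * t + s i := by
      rw [add_right_comm, ← pow_two]
      exact dvd_add (hyi i hiT)
        (((Finset.dvd_prod_of_mem (fun i => p i ^ 2) hiT).mul_left P).mul_right t)
    exact (hp i).1.one_lt.ne' (Nat.isUnit_iff.1 (hsq _ h1))
  · rw [add_right_comm]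
    exact ht i (by simp [hi])

/-- Witness of `k`-independence: for all `k ≥ 1` and `n ≥ 1` there are integers
`b i j` (for `i < k`, `j < n`) and integers `a Δ` indexed by the subsets `Δ` of
`{0, …, n-1}^k` such that `a Δ + b 0 j₀ + ⋯ + b (k-1) j_{k-1}` is squarefree if and
only if `(j₀, …, j_{k-1}) ∈ Δ`. -/
theorem squarefree_k_independence_witness
    (k n : ℕ) (hk : 1 ≤ k) (hn : 1 ≤ n) :
    ∃ b : Fin k → Fin n → ℤ, ∃ a : Set (Fin k → Fin n) → ℤ,
      ∀ Δ : Set (Fin k → Fin n), ∀ j : Fin k → Fin n,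
        (Squarefree (a Δ + ∑ i : Fin k, b i (j i)) ↔ j ∈ Δ) := by
  have : Nonempty (Fin n) := ⟨⟨0, hn⟩⟩
  set P := (2 * Fintype.card (Fin k → Fin n)).factorial with hP
  choose a ha using exists_squarefree_add_iff_mem
    (fun j : Fin k → Fin n => P * (finFunctionFinEquiv j : ℕ))
    (fun j j' h => finFunctionFinEquiv.injective
      (Fin.ext (Nat.eq_of_mul_eq_mul_left (Nat.factorial_pos _) h)))
    (fun j => dvd_mul_right _ _)
  refine ⟨fun i x => ((P * (x * n ^ (i : ℕ)) : ℕ) : ℤ), fun Δ => a Δ, fun Δ j => ?_⟩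
  rw [← ha Δ j, finFunctionFinEquiv_apply, Finset.mul_sum, ← Int.squarefree_natCast]
  push_cast
  rfl
end
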